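/- Suppose there is a type of 'things' with a unary predicate C and a binary predicate O. Suppose a thing R satisfies: C holds of R, and for every thing y, O(R,y) holds if and only if (C holds of y and for all u, O(y,u) implies y ≠ u). Then a contradiction follows (False is derivable). -/

import Mathlib

theorem stmt_3 {Thing : Type*} (C : Thing → Prop) (O : Thing → Thing → Prop)
    (R : Thing) (hC : C R)
    (hO : ∀ y, O R y ↔ (C y ∧ ∀ u, O y u → y ≠ u)) :
    False := by
  have not_mem : ¬ O R R := fun h => ((hO R).mp h).2 R h rfl
  exact not_mem ((hO R).mpr ⟨hC, fun u hu hRu => not_mem (hRu ▸ hu)⟩)
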